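/- For any n ≥ 0, the map σ ↦ sh(P(σ)) (sending a permutation to the underlying unlabeled pair of trees of its Baxter P-symbol) induces a bijection between the set of ≡_B-equivalence classes of permutations of size n and the set of pairs of twin binary trees with n nodes. -/

import Mathlib

/-- The Baxter congruence on words over a totally ordered alphabet. -/
inductive BaxterEquiv {A : Type*} [LinearOrder A] : List A → List A → Prop
  | refl (u : List A) : BaxterEquiv u u
  | symm {u v : List A} : BaxterEquiv u v → BaxterEquiv v u
  | trans {u v w : List A} : BaxterEquiv u v → BaxterEquiv v w → BaxterEquiv u w
  | rel1 (x u v y : List A) (a b c d : A) (hab : a ≤ b) (hbc : b < c) (hcd : c ≤ d) :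
      BaxterEquiv (x ++ c :: u ++ a :: d :: v ++ b :: y)
                  (x ++ c :: u ++ d :: a :: v ++ b :: y)
  | rel2 (x u v y : List A) (a b c d : A) (hab : a < b) (hbc : b ≤ c) (hcd : c < d) :
      BaxterEquiv (x ++ b :: u ++ d :: a :: v ++ c :: y)
                  (x ++ b :: u ++ a :: d :: v ++ c :: y)

/-- `σ` is a permutation of size `n`, viewed as a word. -/
def IsPermWord (n : ℕ) (σ : List ℕ) : Prop :=
  σ.Perm ((List.range n).map (· + 1))

/-- (Unlabeled) binary trees. -/
inductive BTree : Type
  | leaf : BTree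
  | node : BTree → BTree → BTree

namespace BTree

def size : BTree → ℕ
  | leaf => 0
  | node l r => size l + size r + 1

def isLeaf : BTree → Bool
  | leaf => true
  | node _ _ => false

/-- Orientations of all leaves in inorder: `true` = left-oriented, `false` =
right-oriented. -/
def orients : BTree → List Bool
  | leaf => []
  | node l r =>
      (if l.isLeaf then [true] else orients l) ++
      (if r.isLeaf then [false] else orients r)

/-- The canopy: leaf orientations, excluding the first and the last leaf. -/
def canopy (t : BTree) : List Bool := (t.orients.drop 1).dropLast

end BTree

/-- A pair of twin binary trees: same number of nodes, complementary canopies. -/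
def TwinPair (L R : BTree) : Prop :=
  L.size = R.size ∧
  ∀ (i : ℕ) (b b' : Bool), L.canopy[i]? = some b → R.canopy[i]? = some b' → b ≠ b'

/-- Labeled binary trees over `A`. -/
inductive LTree (A : Type*) : Type _
  | leaf : LTree A
  | node : LTree A → A → LTree A → LTree A

namespace LTree

variable {A : Type*}

def shape : LTree A → BTree
  | leaf => .leaf
  | node l _ r => .node (shape l) (shape r)

/-- Leaf insertion into a left binary search tree. -/
def insL [LinearOrder A] : LTree A → A → LTree A
  | leaf, a => node leaf a leaf
  | node l b r, a => if a < b then node (insL l a) b r else node l b (insL r a)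

/-- Leaf insertion into a right binary search tree. -/
def insR [LinearOrder A] : LTree A → A → LTree A
  | leaf, a => node leaf a leaf
  | node l b r, a => if a ≤ b then node (insR l a) b r else node l b (insR r a)

end LTree

/-- Shape of the Baxter P-symbol of a permutation: the underlying unlabeled pair
of binary trees of `(P_L(σ), P_R(σ))`. -/
def shP (σ : List ℕ) : BTree × BTree :=
  ((σ.foldl LTree.insL LTree.leaf).shape, (σ.reverse.foldl LTree.insR LTree.leaf).shape)

namespace LTree

variable {A : Type*}

/-- The labels of a tree, in inorder. -/
def toList : LTree A → List A
  | leaf => []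
  | node l b r => toList l ++ b :: toList r

theorem eq_of_shape_eq : ∀ {s t : LTree A}, s.shape = t.shape → s.toList = t.toList → s = t
  | leaf, leaf, _, _ => rfl
  | leaf, node _ _ _, h, _ => by simp [shape] at h
  | node _ _ _, leaf, h, _ => by simp [shape] at h
  | node l b r, node l' b' r', h, h' => by
    have hlen : ∀ {s t : LTree A}, s.shape = t.shape → s.toList.length = t.toList.length := by
      intro s
      induction s with
      | leaf => intro t ht; cases t <;> simp_all [shape, toList]
      | node l b r ihl ihr =>
        intro t ht
        cases t with
        | leaf => simp [shape] at ht
        | node l' b' r' =>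
          simp only [shape, BTree.node.injEq] at ht
          simp [toList, ihl ht.1, ihr ht.2]
    simp only [shape, BTree.node.injEq] at h
    simp only [toList] at h'
    obtain ⟨h1, h2⟩ := List.append_inj h' (hlen h.1)
    simp only [List.cons.injEq] at h2
    rw [eq_of_shape_eq h.1 h1, eq_of_shape_eq h.2 h2.2, h2.1]

variable [LinearOrder A]

/-- The left binary search tree obtained by leaf inserting the letters of `w` from left to
right. -/
def ofList (w : List A) : LTree A := w.foldl insL leaf

theorem foldl_insL_node (w : List A) (l r : LTree A) (b : A) :
    w.foldl insL (node l b r) =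
      node ((w.filter (· < b)).foldl insL l) b ((w.filter (b ≤ ·)).foldl insL r) := by
  induction w generalizing l r with
  | nil => rfl
  | cons a w ih =>
    by_cases h : a < b
    · simp [insL, h, ih, not_le.2 h]
    · simp [insL, h, ih, not_lt.1 h]

@[simp] theorem ofList_nil : ofList ([] : List A) = leaf := rfl

theorem ofList_cons (b : A) (w : List A) :
    ofList (b :: w) = node (ofList (w.filter (· < b))) b (ofList (w.filter (b ≤ ·))) :=
  foldl_insL_node w leaf leaf b

theorem ofList_concat (w : List A) (a : A) : ofList (w ++ [a]) = insL (ofList w) a := by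
  simp [ofList]

theorem toList_insL_perm (t : LTree A) (a : A) : (insL t a).toList.Perm (a :: t.toList) := by
  induction t with
  | leaf => simp [insL, toList]
  | node l b r ihl ihr =>
    simp only [insL]
    split_ifs
    · exact ihl.append_right _
    · simp only [toList]
      exact ((ihr.cons b).append_left _).trans
        (((List.Perm.swap a b _).append_left _).trans List.perm_middle)

theorem toList_ofList_perm (w : List A) : (ofList w).toList.Perm w := by
  induction w using List.reverseRecOn with
  | nil => exact .refl _
  | append_singleton w a ih =>
    rw [ofList_concat]
    exact (toList_insL_perm _ _).trans ((ih.cons a).trans (List.perm_append_singleton a w).symm)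

theorem mem_toList_ofList {w : List A} {a : A} : a ∈ (ofList w).toList ↔ a ∈ w :=
  (toList_ofList_perm w).mem_iff

theorem toList_ofList_pairwise (w : List A) : (ofList w).toList.Pairwise (· ≤ ·) := by
  induction hn : w.length using Nat.strong_induction_on generalizing w with
  | _ n ih =>
    cases w with
    | nil => simp [toList]
    | cons b w =>
      have hl := ih _ (by
        have := List.length_filter_le (fun x => decide (x < b)) w
        simp only [List.length_cons] at hn; omega) (w.filter (· < b)) rfl
      have hr := ih _ (by
        have := List.length_filter_le (fun x => decide (b ≤ x)) w
        simp only [List.length_cons] at hn; omega) (w.filter (b ≤ ·)) rfl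
      rw [ofList_cons]
      simp only [toList, List.pairwise_append, List.pairwise_cons, hl, hr, List.mem_cons,
        mem_toList_ofList, List.mem_filter, decide_eq_true_eq, true_and, and_true]
      refine ⟨fun _ h => h.2, ?_⟩
      rintro x ⟨-, hx⟩ y (rfl | ⟨-, hy⟩)
      · exact hx.le
      · exact hx.le.trans hy

theorem ofList_eq_of_shape_eq {v w : List A} (h : v.Perm w)
    (hs : (ofList v).shape = (ofList w).shape) : ofList v = ofList w :=
  eq_of_shape_eq hs <|
    ((toList_ofList_perm v).trans (h.trans (toList_ofList_perm w).symm)).eq_of_pairwise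
      (fun _ _ _ _ => le_antisymm) (toList_ofList_pairwise v) (toList_ofList_pairwise w)

theorem insR_eq_insL {t : LTree A} {a : A} (h : a ∉ t.toList) : insR t a = insL t a := by
  induction t with
  | leaf => rfl
  | node l b r ihl ihr =>
    simp only [toList, List.mem_append, List.mem_cons, not_or] at h
    have : a ≤ b ↔ a < b := ⟨fun h' => lt_of_le_of_ne h' h.2.1, le_of_lt⟩
    simp only [insL, insR, this, ihl h.1, ihr h.2.2]

theorem foldl_insR_eq_ofList {w : List A} (h : w.Nodup) : w.foldl insR leaf = ofList w := by
  induction w using List.reverseRecOn with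
  | nil => rfl
  | append_singleton w a ih =>
    rw [List.nodup_append] at h
    rw [List.foldl_concat, ih h.1, ofList_concat, insR_eq_insL]
    rw [mem_toList_ofList]
    exact fun ha => h.2.2 a ha a (by simp) rfl

/-- Two adjacent letters separated by an earlier letter may be exchanged. -/
theorem ofList_swap {x y : List A} {a c d : A} (hc : c ∈ x) (hac : a < c) (hcd : c ≤ d) :
    ofList (x ++ a :: d :: y) = ofList (x ++ d :: a :: y) := by
  induction hn : x.length using Nat.strong_induction_on generalizing x y with
  | _ n ih =>
    cases x with
    | nil => simp at hc
    | cons b x =>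
      have hlt := List.length_filter_le (fun x => decide (x < b)) x
      have hge := List.length_filter_le (fun x => decide (b ≤ x)) x
      simp only [List.length_cons] at hn
      simp only [List.cons_append, ofList_cons, List.filter_append, List.filter_cons]
      rcases lt_or_ge a b with hab | hba
      · rcases lt_or_ge d b with hdb | hbd
        · have hcb := hcd.trans_lt hdb
          have hcx : c ∈ x.filter (· < b) := by
            rcases List.mem_cons.1 hc with rfl | h
            · exact absurd hcb (lt_irrefl _)
            · simp [h, hcb]
          simp [hab, hdb, not_le.2 hab, not_le.2 hdb,
            ih _ (by omega) (y := y.filter (· < b)) hcx rfl]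
        · simp [hab, hbd, not_le.2 hab, not_lt.2 hbd]
      · have hbd : b ≤ d := hba.trans (hac.le.trans hcd)
        have hbc := hba.trans_lt hac
        have hcx : c ∈ x.filter (b ≤ ·) := by
          rcases List.mem_cons.1 hc with rfl | h
          · exact absurd hbc (lt_irrefl _)
          · simp [h, hbc.le]
        simp [hba, hbd, not_lt.2 hba, not_lt.2 hbd,
          ih _ (by omega) (y := y.filter (b ≤ ·)) hcx rfl]

/-- If two words have the same tree but order the letters `a`, `d`, adjacent in the first one,
differently, then these letters are separated by an earlier letter of the first word. -/
theorem exists_between_of_ofList_eq {x y w : List A} {a d : A} (hnd : (x ++ a :: d :: y).Nodup)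
    (h : ofList (x ++ a :: d :: y) = ofList w) (hw : [d, a].Sublist w) :
    ∃ c ∈ x, (a < c ∧ c < d) ∨ (d < c ∧ c < a) := by
  have hndw : w.Nodup := by
    have := (toList_ofList_perm (x ++ a :: d :: y)).symm.trans (h ▸ toList_ofList_perm w)
    exact this.nodup_iff.1 hnd
  induction hn : x.length using Nat.strong_induction_on generalizing x y w with
  | _ n ih =>
    cases w with
    | nil => simp at hw
    | cons k w =>
      cases x with
      | nil =>
        simp only [List.nil_append, ofList_cons, node.injEq] at h
        obtain ⟨-, rfl, -⟩ := h
        simp only [List.nil_append, List.nodup_cons, List.mem_cons, not_or] at hnd hndw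
        cases hw with
        | cons _ hw => exact absurd (hw.subset (by simp)) hndw.1
        | cons_cons _ hw => exact absurd rfl hnd.1.1
      | cons b x =>
        simp only [List.cons_append, ofList_cons, node.injEq] at h
        obtain ⟨hl, rfl, hr⟩ := h
        have hlt := List.length_filter_le (fun x => decide (x < b)) x
        have hge := List.length_filter_le (fun x => decide (b ≤ x)) x
        simp only [List.length_cons] at hn
        simp only [List.cons_append, List.nodup_cons, List.mem_append, List.mem_cons,
          not_or] at hnd hndw
        obtain ⟨⟨-, hba, hbd, -⟩, hnd⟩ := hnd
        have hw' : [d, a].Sublist w := by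
          cases hw with
          | cons _ hw => exact hw
          | cons_cons _ hw => exact absurd rfl hbd
        rcases lt_or_gt_of_ne hba with h1 | h1 <;> rcases lt_or_gt_of_ne hbd with h2 | h2
        · obtain ⟨c, hc, hc'⟩ := ih _ (by omega) (x := x.filter (b ≤ ·))
            (y := y.filter (b ≤ ·)) (w := w.filter (b ≤ ·))
            (by simpa [h1.le, h2.le] using hnd.filter (b ≤ ·))
            (by simpa [h1.le, h2.le] using hr)
            (by simpa [h1.le, h2.le] using hw'.filter (b ≤ ·))
            (hndw.2.filter _) rfl
          exact ⟨c, List.mem_cons_of_mem _ (List.mem_filter.1 hc).1, hc'⟩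
        · exact ⟨b, by simp, .inr ⟨h2, h1⟩⟩
        · exact ⟨b, by simp, .inl ⟨h1, h2⟩⟩
        · obtain ⟨c, hc, hc'⟩ := ih _ (by omega) (x := x.filter (· < b))
            (y := y.filter (· < b)) (w := w.filter (· < b))
            (by simpa [h1, h2] using hnd.filter (· < b))
            (by simpa [h1, h2] using hl)
            (by simpa [h1, h2] using hw'.filter (· < b))
            (hndw.2.filter _) rfl
          exact ⟨c, List.mem_cons_of_mem _ (List.mem_filter.1 hc).1, hc'⟩

end LTree

open LTree

namespace BaxterEquiv

variable {A : Type*} [LinearOrder A] {u v : List A}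

theorem perm (h : BaxterEquiv u v) : u.Perm v := by
  induction h with
  | refl u => exact .refl u
  | symm _ ih => exact ih.symm
  | trans _ _ ih ih' => exact ih.trans ih'
  | rel1 x u v y a b c d =>
    simp only [List.append_assoc, List.cons_append]
    exact .append_left _ (.cons _ (.append_left _ (.swap ..)))
  | rel2 x u v y a b c d =>
    simp only [List.append_assoc, List.cons_append]
    exact .append_left _ (.cons _ (.append_left _ (.swap ..)))

theorem ofList_eq (h : BaxterEquiv u v) : ofList u = ofList v := by
  induction h with
  | refl u => rfl
  | symm _ ih => exact ih.symm
  | trans _ _ ih ih' => exact ih.trans ih'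
  | rel1 x u v y a b c d hab hbc hcd =>
    simpa using ofList_swap (x := x ++ c :: u) (y := v ++ b :: y) (by simp)
      (hab.trans_lt hbc) hcd
  | rel2 x u v y a b c d hab hbc hcd =>
    simpa using (ofList_swap (x := x ++ b :: u) (y := v ++ c :: y) (by simp)
      hab (hbc.trans hcd.le)).symm

theorem ofList_reverse_eq (h : BaxterEquiv u v) (hu : u.Nodup) :
    ofList u.reverse = ofList v.reverse := by
  induction h with
  | refl u => rfl
  | symm h ih => exact (ih (h.perm.nodup_iff.2 hu)).symm
  | trans h _ ih ih' => exact (ih hu).trans (ih' (h.perm.nodup_iff.1 hu))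
  | rel1 x u v y a b c d hab hbc hcd =>
    have hne : a ≠ b := by rintro rfl; simp [List.nodup_append] at hu
    simpa using (ofList_swap (x := y.reverse ++ b :: v.reverse) (y := u.reverse ++ c :: x.reverse)
      (by simp) (lt_of_le_of_ne hab hne) (hbc.le.trans hcd)).symm
  | rel2 x u v y a b c d hab hbc hcd =>
    simpa using ofList_swap (x := y.reverse ++ c :: v.reverse) (y := u.reverse ++ b :: x.reverse)
      (by simp) (hab.trans_le hbc) hcd.le

theorem of_between_lt {x y : List A} {a b c d : A} (hb : b ∈ y) (hc : c ∈ x)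
    (hab : a < b) (hbd : b < d) (hac : a < c) (hcd : c < d) :
    BaxterEquiv (x ++ a :: d :: y) (x ++ d :: a :: y) := by
  obtain ⟨x, u, rfl⟩ := List.append_of_mem hc
  obtain ⟨v, y, rfl⟩ := List.append_of_mem hb
  rcases lt_or_ge b c with h | h
  · simpa using rel1 x u v y a b c d hab.le h hcd.le
  · simpa using (rel2 x u v y a c b d hac h hbd).symm

/-- Adjacent letters in the first of two words with equal `P`-symbols which are in the opposite
order in the second one may be exchanged. -/
theorem of_ofList_eq_of_sublist {x y w : List A} {a d : A} (hnd : (x ++ a :: d :: y).Nodup)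
    (h : ofList (x ++ a :: d :: y) = ofList w)
    (h' : ofList (x ++ a :: d :: y).reverse = ofList w.reverse) (hw : [d, a].Sublist w) :
    BaxterEquiv (x ++ a :: d :: y) (x ++ d :: a :: y) := by
  obtain ⟨c, hc, hc'⟩ := exists_between_of_ofList_eq hnd h hw
  obtain ⟨b, hb, hb'⟩ := exists_between_of_ofList_eq (x := y.reverse) (y := x.reverse)
    (a := d) (d := a) (w := w.reverse) (by simpa using List.nodup_reverse.2 hnd)
    (by simpa using h') (by simpa using hw.reverse)
  rw [List.mem_reverse] at hb
  rcases hc' with ⟨h1, h2⟩ | ⟨h1, h2⟩ <;> rcases hb' with ⟨h3, h4⟩ | ⟨h3, h4⟩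
  · exact absurd ((h1.trans h2).trans (h3.trans h4)) (lt_irrefl _)
  · exact of_between_lt hb hc h3 h4 h1 h2
  · exact (of_between_lt hb hc h3 h4 h1 h2).symm
  · exact absurd ((h1.trans h2).trans (h3.trans h4)) (lt_irrefl _)

theorem move_to_front {p x y w : List A} {k : A} (hnd : (p ++ x ++ k :: y).Nodup)
    (h : ofList (p ++ x ++ k :: y) = ofList w)
    (h' : ofList (p ++ x ++ k :: y).reverse = ofList w.reverse)
    (hw : ∀ a ∈ x, [k, a].Sublist w) :
    BaxterEquiv (p ++ x ++ k :: y) (p ++ k :: x ++ y) := by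
  induction x using List.reverseRecOn generalizing y with
  | nil => simpa using refl _
  | append_singleton x a ih =>
    have e1 : p ++ (x ++ [a]) ++ k :: y = (p ++ x) ++ a :: k :: y := by simp
    rw [e1] at hnd h h' ⊢
    have hswap := of_ofList_eq_of_sublist hnd h h' (hw a (by simp))
    have := ih (y := a :: y) (hswap.perm.nodup_iff.1 hnd) (hswap.ofList_eq.symm.trans h)
      ((hswap.ofList_reverse_eq hnd).symm.trans h') fun b hb => hw b (by simp [hb])
    simpa using hswap.trans this

theorem of_ofList_eq {p u v : List A} (hnd : (p ++ u).Nodup) (hp : u.Perm v)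
    (h : ofList (p ++ u) = ofList (p ++ v))
    (h' : ofList (p ++ u).reverse = ofList (p ++ v).reverse) : BaxterEquiv (p ++ u) (p ++ v) := by
  induction v generalizing p u with
  | nil => rw [hp.eq_nil]; exact refl _
  | cons k v ih =>
    obtain ⟨x, y, rfl⟩ := List.append_of_mem (hp.mem_iff.2 List.mem_cons_self)
    have hxy : (x ++ y).Perm v := (List.perm_middle.symm.trans hp).cons_inv
    rw [← List.append_assoc] at hnd h h' ⊢
    have hm := move_to_front hnd h h' fun a ha => by
      have : a ∈ v := hxy.mem_iff.1 (by simp [ha])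
      exact ((List.singleton_sublist.2 this).cons_cons k).trans (List.sublist_append_right _ _)
    have := ih (p := p ++ [k]) (u := x ++ y) (by simpa using hm.perm.nodup_iff.1 hnd) hxy
      (by simpa using hm.ofList_eq.symm.trans h)
      (by simpa using (hm.ofList_reverse_eq hnd).symm.trans h')
    simpa using hm.trans (by simpa using this)

end BaxterEquiv

namespace BTree

/-- Orientations of all leaves in inorder, where `o` is the orientation of the tree itself if it
is a leaf. -/
def leafOrients : BTree → Bool → List Bool
  | leaf, o => [o]
  | node l r, _ => leafOrients l true ++ leafOrients r false

theorem orients_node (l r : BTree) (o : Bool) : (node l r).orients = (node l r).leafOrients o := by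
  have h : ∀ (t : BTree) (o : Bool), (if t.isLeaf then [o] else t.orients) = t.leafOrients o := by
    intro t
    induction t with
    | leaf => simp [isLeaf, leafOrients]
    | node l r ihl ihr =>
      intro o
      simp only [orients, leafOrients, ihl, ihr]
      rfl
  simp only [orients, h, leafOrients]

theorem length_leafOrients (t : BTree) (o : Bool) : (t.leafOrients o).length = t.size + 1 := by
  induction t generalizing o with
  | leaf => rfl
  | node l r ihl ihr => simp only [leafOrients, List.length_append, ihl, ihr, size]; omega

theorem exists_leafOrients_node (l r : BTree) :
    ∃ C, ∀ o, (node l r).leafOrients o = true :: C ++ [false] := by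
  have hl : ∀ t : BTree, ∃ C, t.leafOrients true = true :: C := by
    intro t
    induction t with
    | leaf => exact ⟨[], rfl⟩
    | node l r ihl ihr =>
      obtain ⟨C, hC⟩ := ihl
      exact ⟨C ++ r.leafOrients false, by simp [leafOrients, hC]⟩
  have hr : ∀ t : BTree, ∃ C, t.leafOrients false = C ++ [false] := by
    intro t
    induction t with
    | leaf => exact ⟨[], rfl⟩
    | node l r ihl ihr =>
      obtain ⟨C, hC⟩ := ihr
      exact ⟨l.leafOrients true ++ C, by simp [leafOrients, hC]⟩
  obtain ⟨C, hC⟩ := hl l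
  obtain ⟨D, hD⟩ := hr r
  exact ⟨C ++ D, fun o => by simp [leafOrients, hC, hD]⟩

theorem leafOrients_node_eq_canopy (l r : BTree) (o : Bool) :
    (node l r).leafOrients o = true :: (node l r).canopy ++ [false] := by
  obtain ⟨C, hC⟩ := exists_leafOrients_node l r
  rw [canopy, orients_node l r o, hC]
  rw [List.cons_append, List.drop_one, List.tail_cons, List.dropLast_concat,
    List.cons_append]

theorem length_canopy (t : BTree) : t.canopy.length = t.size - 1 := by
  cases t with
  | leaf => rfl
  | node l r =>
    have := length_leafOrients (node l r) true
    rw [leafOrients_node_eq_canopy] at this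
    simp at this
    omega

end BTree

theorem TwinPair.canopy_eq {L R : BTree} (h : TwinPair L R) : R.canopy = L.canopy.map (!·) := by
  have hlen : L.canopy.length = R.canopy.length := by simp [BTree.length_canopy, h.1]
  apply List.ext_getElem (by simp [hlen])
  intro i h1 h2
  have := h.2 i _ _ (List.getElem?_eq_getElem (hlen ▸ h1)) (List.getElem?_eq_getElem h1)
  revert this
  simp only [List.getElem_map]
  cases L.canopy[i] <;> cases R.canopy[i] <;> simp

namespace LTree

theorem size_shape {A : Type*} (t : LTree A) : t.shape.size = t.toList.length := by
  induction t with
  | leaf => rfl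
  | node l b r ihl ihr =>
    simp [shape, BTree.size, ihl, ihr, toList, add_assoc]

/-- The leaf preceding the label `k + 1` in the tree of a word is left-oriented if and only if `k`
appears before `k + 1` in the word. -/
theorem leafOrients_ofList {w : List ℕ} {s n : ℕ} {o : Bool} {f : ℕ → Bool}
    (hw : w.Perm (List.range' s n))
    (hf : ∀ k, s ≤ k → k + 1 < s + n → (f (k + 1) = true ↔ [k, k + 1].Sublist w))
    (h0 : n = 0 → f s = o) (hs : 0 < n → f s = true) (he : 0 < n → f (s + n) = false) :
    (ofList w).shape.leafOrients o = (List.range' s (n + 1)).map f := by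
  induction n using Nat.strong_induction_on generalizing w s o with
  | _ n ih =>
    cases w with
    | nil =>
      have : n = 0 := by simpa using hw.length_eq.symm
      subst this
      simp [shape, BTree.leafOrients, h0]
    | cons b w =>
      have hb : b ∈ List.range' s n := hw.mem_iff.1 (by simp)
      have hnd : (b :: w).Nodup := hw.nodup_iff.2 List.nodup_range'
      have hmem : ∀ k, k ∈ b :: w ↔ s ≤ k ∧ k < s + n := fun k => by
        rw [hw.mem_iff, List.mem_range'_1]
      rw [List.mem_range'_1] at hb
      obtain ⟨p, rfl⟩ := Nat.exists_eq_add_of_le hb.1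
      obtain ⟨q, rfl⟩ : ∃ q, n = p + 1 + q := Nat.exists_eq_add_of_le (by omega)
      have hr : List.range' s (p + 1 + q) =
          List.range' s p ++ (s + p) :: List.range' (s + p + 1) q := by
        rw [add_assoc, List.range'_append_1.symm, add_comm 1 q, List.range'_succ]
      have hw' : w.Perm (List.range' s p ++ List.range' (s + p + 1) q) := by
        rw [hr] at hw
        exact (hw.trans List.perm_middle).cons_inv
      have hnot := (List.nodup_cons.1 hnd).1
      have hl : (w.filter (· < s + p)).Perm (List.range' s p) := by
        refine (hw'.filter _).trans (.of_eq ?_)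
        rw [List.filter_append, List.filter_eq_self.2, List.filter_eq_nil_iff.2, List.append_nil]
        · simp; omega
        · simp
      have hr : (w.filter (s + p ≤ ·)).Perm (List.range' (s + p + 1) q) := by
        refine (hw'.filter _).trans (.of_eq ?_)
        rw [List.filter_append, (List.filter_eq_nil_iff (l := List.range' s p)).2,
          List.filter_eq_self.2, List.nil_append]
        · simp; omega
        · simp
      have hsub : ∀ k, k ≠ s + p → ([k, k + 1].Sublist ((s + p) :: w) ↔ [k, k + 1].Sublist w) := by
        intro k hk
        refine ⟨fun h => ?_, fun h => h.cons _⟩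
        cases h with
        | cons _ h => exact h
        | cons_cons => exact absurd rfl hk
      have hfil : ∀ (g : ℕ → Bool) (k : ℕ), g k = true → g (k + 1) = true →
          ([k, k + 1].Sublist (w.filter g) ↔ [k, k + 1].Sublist w) := by
        intro g k h1 h2
        exact ⟨fun h => h.trans List.filter_sublist, fun h => by simpa [h1, h2] using h.filter g⟩
      have hlast : 0 < p → f (s + p) = false := by
        intro hp
        have := (hf (s + p - 1) (by omega) (by omega)).not.2 (by
          rw [hsub _ (by omega), show s + p - 1 + 1 = s + p by omega]
          exact fun h => hnot (h.subset (by simp)))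
        rwa [show s + p - 1 + 1 = s + p by omega, Bool.not_eq_true] at this
      have hfirst : 0 < q → f (s + p + 1) = true := by
        intro hq
        refine (hf (s + p) (by omega) (by omega)).2 ?_
        have : s + p + 1 ∈ w := by
          have := (hmem (s + p + 1)).2 (by omega)
          simpa using this
        exact (List.singleton_sublist.2 this).cons_cons _
      have e1 := ih p (by omega) (o := true) hl
        (fun k h1 h2 => by
          rw [hf k h1 (by omega), hsub k (by omega), hfil _ k (by simp; omega) (by simp; omega)])
        (fun h => hs (by omega)) (fun h => hs (by omega)) hlast
      have e2 := ih q (by omega) (o := false) hr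
        (fun k h1 h2 => by
          rw [hf k (by omega) (by omega), hsub k (by omega),
            hfil _ k (by simp; omega) (by simp; omega)])
        (fun h => by rw [← he (by omega), h]; rfl) hfirst
        (fun h => by rw [← he (by omega)]; congr 1; omega)
      rw [ofList_cons, shape, BTree.leafOrients, e1, e2, ← List.map_append,
        show p + 1 + q + 1 = (p + 1) + (q + 1) by omega, add_assoc s p 1, List.range'_append_1]

theorem canopy_ofList {w : List ℕ} {s n : ℕ} (hw : w.Perm (List.range' s n)) :
    (ofList w).shape.canopy =
      (List.range' s (n - 1)).map fun k => decide ([k, k + 1].Sublist w) := by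
  cases n with
  | zero => rw [hw.eq_nil]; rfl
  | succ n =>
    let f : ℕ → Bool := fun k => decide (k = s) ||
      (decide (k ≠ s + (n + 1)) && decide ([k - 1, k].Sublist w))
    have h := leafOrients_ofList (o := true) (f := f) hw
      (fun k h1 h2 => by
        have e1 : k + 1 ≠ s := by omega
        simp only [f, e1]
        simp only [decide_false, Bool.false_or, Bool.and_eq_true, decide_eq_true_eq,
          Nat.add_sub_cancel, and_iff_right_iff_imp]
        exact fun _ => by omega)
      (by simp) (by simp [f]) (by simp [f])
    cases w with
    | nil => simpa using hw.length_eq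
    | cons b w =>
      rw [ofList_cons, shape] at h ⊢
      rw [BTree.canopy, BTree.orients_node _ _ true, h, List.range'_succ, List.range'_1_concat]
      simp only [List.map_cons, List.map_append, List.drop_one, List.tail_cons, List.map_nil,
        List.dropLast_concat, Nat.add_sub_cancel]
      apply List.ext_getElem (by simp)
      intro i h1 h2
      have hi : i < n := by simpa using h1
      have e1 : s + 1 + i ≠ s := by omega
      simp only [f, List.getElem_map, List.getElem_range', one_mul, e1]
      simp only [show s + 1 + i = s + i + 1 by omega, decide_false, Bool.false_or,
        Nat.add_sub_cancel, ne_eq, show ¬ s + i + 1 = s + (n + 1) by omega, not_false_eq_true,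
        decide_true, Bool.true_and]

end LTree

theorem List.Nodup.pair_sublist_reverse_iff {A : Type*} {w : List A} {a b : A} (hw : w.Nodup)
    (ha : a ∈ w) (hb : b ∈ w) (hab : a ≠ b) : [a, b].Sublist w.reverse ↔ ¬ [a, b].Sublist w := by
  rw [← List.reverse_reverse [a, b], List.reverse_sublist]
  simp only [List.reverse_cons, List.reverse_nil, List.nil_append, List.singleton_append]
  induction w with
  | nil => simp at ha
  | cons c w ih =>
    rw [List.nodup_cons] at hw
    rw [List.cons_sublist_cons', List.cons_sublist_cons', List.singleton_sublist,
      List.singleton_sublist]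
    have hs : ∀ {x y : A}, [x, y].Sublist w → x ∈ w ∧ y ∈ w := fun h =>
      ⟨h.subset (by simp), h.subset (by simp)⟩
    grind

theorem twinPair_ofList {w : List ℕ} {s n : ℕ} (hw : w.Perm (List.range' s n)) :
    TwinPair (LTree.ofList w).shape (LTree.ofList w.reverse).shape := by
  refine ⟨?_, fun i b b' h h' => ?_⟩
  · simp [LTree.size_shape, (LTree.toList_ofList_perm _).length_eq]
  · rw [LTree.canopy_ofList hw, List.getElem?_map, Option.map_eq_some_iff] at h
    rw [LTree.canopy_ofList ((List.reverse_perm w).trans hw), List.getElem?_map,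
      Option.map_eq_some_iff] at h'
    obtain ⟨k, hk, rfl⟩ := h
    obtain ⟨k', hk', rfl⟩ := h'
    obtain rfl : k = k' := Option.some.inj (hk.symm.trans hk')
    have hkn := List.mem_range'_1.1 (List.mem_of_getElem? hk)
    have hm : ∀ j, s ≤ j → j < s + n → j ∈ w := fun j h1 h2 =>
      hw.mem_iff.2 (List.mem_range'_1.2 ⟨h1, h2⟩)
    have := List.Nodup.pair_sublist_reverse_iff (hw.nodup_iff.2 List.nodup_range')
      (hm k hkn.1 (by omega)) (hm (k + 1) (by omega) (by omega)) (by omega)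
    simp [this]

namespace LTree

variable {A : Type*}

/-- The leaf orientations and the labels of a tree in inorder, where `o` is the orientation of the
tree itself if it is a leaf. -/
def inorder : LTree A → Bool → List (Bool ⊕ A)
  | leaf, o => [.inl o]
  | node l b r, _ => inorder l true ++ .inr b :: inorder r false

theorem exists_inorder_left (t : LTree A) : ∃ C, t.inorder true = .inl true :: C := by
  induction t with
  | leaf => exact ⟨[], rfl⟩
  | node l b r ihl ihr =>
    obtain ⟨C, hC⟩ := ihl
    exact ⟨C ++ .inr b :: r.inorder false, by simp [inorder, hC]⟩

theorem exists_inorder_right (t : LTree A) : ∃ C, t.inorder false = C ++ [.inl false] := by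
  induction t with
  | leaf => exact ⟨[], rfl⟩
  | node l b r ihl ihr =>
    obtain ⟨C, hC⟩ := ihr
    exact ⟨l.inorder true ++ .inr b :: C, by simp [inorder, hC]⟩

theorem exists_inorder_node (l : LTree A) (b : A) (r : LTree A) :
    ∃ C, ∀ o, (node l b r).inorder o = .inl true :: C ++ [.inl false] := by
  obtain ⟨C, hC⟩ := exists_inorder_left l
  obtain ⟨D, hD⟩ := exists_inorder_right r
  exact ⟨C ++ .inr b :: D, fun o => by simp [inorder, hC, hD]⟩

theorem inr_mem_inorder {t : LTree A} {o : Bool} {a : A} : .inr a ∈ t.inorder o ↔ a ∈ t.toList := by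
  induction t generalizing o with
  | leaf => simp [inorder, toList]
  | node l b r ihl ihr => simp [inorder, toList, ihl, ihr]

theorem filterMap_inorder (t : LTree A) (o : Bool) :
    (t.inorder o).filterMap Sum.getRight? = t.toList := by
  induction t generalizing o with
  | leaf => simp [inorder, toList]
  | node l b r ihl ihr => simp [inorder, toList, ihl, ihr]

/-- Graft `r` at the last leaf of `l`. -/
def graftLast : LTree A → LTree A → LTree A
  | leaf, r => r
  | node l b l', r => node l b (graftLast l' r)

/-- Graft `l` at the first leaf of `r`. -/
def graftFirst (l : LTree A) : LTree A → LTree A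
  | leaf => l
  | node r b r' => node (graftFirst l r) b r'

theorem inorder_graftLast {l r : LTree A} {C : List (Bool ⊕ A)} {o : Bool}
    (hl : l.inorder o = C ++ [.inl false]) : (graftLast l r).inorder o = C ++ r.inorder false := by
  induction l generalizing C o with
  | leaf =>
    cases C with
    | nil => simp [inorder] at hl; simp [graftLast, hl]
    | cons c C => simp [inorder] at hl
  | node l b l' _ ih =>
    obtain ⟨D, hD⟩ := exists_inorder_right l'
    simp only [inorder, hD] at hl
    rw [← List.cons_append, ← List.append_assoc] at hl
    simp [graftLast, inorder, ih hD, ← List.append_cancel_right hl]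

theorem inorder_graftFirst {l r : LTree A} {C : List (Bool ⊕ A)} {o : Bool}
    (hr : r.inorder o = .inl true :: C) : (graftFirst l r).inorder o = l.inorder true ++ C := by
  induction r generalizing C o with
  | leaf =>
    simp only [inorder, List.cons.injEq, Sum.inl.injEq] at hr
    simp [graftFirst, ← hr.2, hr.1]
  | node r b r' ih _ =>
    obtain ⟨D, hD⟩ := exists_inorder_left r
    simp only [inorder, hD, List.cons_append, List.cons.injEq, true_and] at hr
    simp [graftFirst, inorder, ih hD, ← hr]

variable [LinearOrder A]

/-- The restriction of a left binary search tree to the labels smaller than `h`. -/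
def cutLt (h : A) : LTree A → LTree A
  | leaf => leaf
  | node l b r => if b < h then node l b (cutLt h r) else cutLt h l

/-- The restriction of a left binary search tree to the labels which are at least `h`. -/
def cutGe (h : A) : LTree A → LTree A
  | leaf => leaf
  | node l b r => if b < h then cutGe h r else node (cutGe h l) b r

theorem cutLt_insL (h a : A) (t : LTree A) :
    cutLt h (insL t a) = if a < h then insL (cutLt h t) a else cutLt h t := by
  induction t with
  | leaf => by_cases ha : a < h <;> simp [insL, cutLt, ha]
  | node l b r ihl ihr =>
    by_cases hab : a < b <;> by_cases hbh : b < h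
    · simp [insL, cutLt, hab, hbh, hab.trans hbh]
    · simp [insL, cutLt, hab, hbh, ihl]
    · by_cases ha : a < h <;> simp [insL, cutLt, hab, hbh, ihr, ha]
    · simp [insL, cutLt, hab, hbh, ((not_lt.1 hbh).trans (not_lt.1 hab)).not_gt]

theorem cutGe_insL (h a : A) (t : LTree A) :
    cutGe h (insL t a) = if h ≤ a then insL (cutGe h t) a else cutGe h t := by
  induction t with
  | leaf => by_cases ha : a < h <;> simp [insL, cutGe, ha, ← not_lt]
  | node l b r ihl ihr =>
    by_cases hab : a < b <;> by_cases hbh : b < h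
    · simp [insL, cutGe, hab, hbh, hab.trans hbh, ← not_lt]
    · by_cases ha : a < h <;> simp [insL, cutGe, hab, hbh, ihl, ha, ← not_lt]
    · simp [insL, cutGe, hab, hbh, ihr]
    · simp [insL, cutGe, hab, hbh, ((not_lt.1 hbh).trans (not_lt.1 hab))]

theorem ofList_filter_lt (h : A) (w : List A) :
    ofList (w.filter (· < h)) = cutLt h (ofList w) := by
  induction w using List.reverseRecOn with
  | nil => rfl
  | append_singleton w a ih =>
    rw [ofList_concat, cutLt_insL, ← ih, List.filter_append]
    by_cases ha : a < h <;> simp [ha, ofList_concat]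

theorem ofList_filter_ge (h : A) (w : List A) :
    ofList (w.filter (h ≤ ·)) = cutGe h (ofList w) := by
  induction w using List.reverseRecOn with
  | nil => rfl
  | append_singleton w a ih =>
    rw [ofList_concat, cutGe_insL, ← ih, List.filter_append]
    by_cases ha : h ≤ a <;> simp [ha, ofList_concat]

section Cut

variable {h : A} {l r : LTree A}

theorem cutLt_eq_self (hl : ∀ a ∈ l.toList, a < h) : cutLt h l = l := by
  induction l with
  | leaf => rfl
  | node l b l' _ ih =>
    simp [cutLt, hl b (by simp [toList]), ih fun a ha => hl a (by simp [toList, ha])]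

theorem cutLt_eq_leaf (hr : ∀ a ∈ r.toList, h ≤ a) : cutLt h r = leaf := by
  induction r with
  | leaf => rfl
  | node r b r' ih _ =>
    simp [cutLt, (hr b (by simp [toList])).not_gt, ih fun a ha => hr a (by simp [toList, ha])]

theorem cutGe_eq_self (hr : ∀ a ∈ r.toList, h ≤ a) : cutGe h r = r := by
  induction r with
  | leaf => rfl
  | node r b r' ih _ =>
    simp [cutGe, (hr b (by simp [toList])).not_gt, ih fun a ha => hr a (by simp [toList, ha])]

theorem cutGe_eq_leaf (hl : ∀ a ∈ l.toList, a < h) : cutGe h l = leaf := by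
  induction l with
  | leaf => rfl
  | node l b l' _ ih =>
    simp [cutGe, hl b (by simp [toList]), ih fun a ha => hl a (by simp [toList, ha])]

theorem cutLt_graftLast (hl : ∀ a ∈ l.toList, a < h) (hr : ∀ a ∈ r.toList, h ≤ a) :
    cutLt h (graftLast l r) = l := by
  induction l with
  | leaf => exact cutLt_eq_leaf hr
  | node l b l' _ ih =>
    simp [cutLt, graftLast, hl b (by simp [toList]), ih fun a ha => hl a (by simp [toList, ha])]

theorem cutGe_graftLast (hl : ∀ a ∈ l.toList, a < h) (hr : ∀ a ∈ r.toList, h ≤ a) :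
    cutGe h (graftLast l r) = r := by
  induction l with
  | leaf => exact cutGe_eq_self hr
  | node l b l' _ ih =>
    simp [cutGe, graftLast, hl b (by simp [toList]), ih fun a ha => hl a (by simp [toList, ha])]

theorem cutLt_graftFirst (hl : ∀ a ∈ l.toList, a < h) (hr : ∀ a ∈ r.toList, h ≤ a) :
    cutLt h (graftFirst l r) = l := by
  induction r with
  | leaf => exact cutLt_eq_self hl
  | node r b r' ih _ =>
    simp [cutLt, graftFirst, (hr b (by simp [toList])).not_gt,
      ih fun a ha => hr a (by simp [toList, ha])]

theorem cutGe_graftFirst (hl : ∀ a ∈ l.toList, a < h) (hr : ∀ a ∈ r.toList, h ≤ a) :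
    cutGe h (graftFirst l r) = r := by
  induction r with
  | leaf => exact cutGe_eq_leaf hl
  | node r b r' ih _ =>
    simp [cutGe, graftFirst, (hr b (by simp [toList])).not_gt,
      ih fun a ha => hr a (by simp [toList, ha])]

end Cut

theorem _root_.List.eq_or_exists_of_append_cons_eq {α : Type*} {l₁ l₂ m₁ m₂ : List α} {x y : α}
    (h : l₁ ++ x :: l₂ = m₁ ++ y :: m₂) :
    (l₁ = m₁ ∧ x = y ∧ l₂ = m₂) ∨ (∃ M, m₁ = l₁ ++ x :: M ∧ l₂ = M ++ y :: m₂) ∨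
      ∃ M, l₁ = m₁ ++ y :: M ∧ m₂ = M ++ x :: l₂ := by
  rcases List.append_eq_append_iff.1 h with ⟨_ | ⟨_, M⟩, h1, h2⟩ | ⟨_ | ⟨_, M⟩, h1, h2⟩ <;>
    simp_all

/-- A node without children is removed by undoing a leaf insertion. -/
theorem exists_insL_eq {t : LTree A} {o : Bool} {h : A} {P Q : List (Bool ⊕ A)}
    (ht : t.inorder o = P ++ .inl true :: .inr h :: .inl false :: Q)
    (hP : ∀ a, .inr a ∈ P → a < h) (hQ : ∀ a, .inr a ∈ Q → h < a) :
    ∃ t' o', t'.inorder o = P ++ .inl o' :: Q ∧ insL t' h = t := by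
  induction t generalizing o P Q with
  | leaf => cases P <;> simp [inorder] at ht
  | node l b r ihl ihr =>
    simp only [inorder] at ht
    rw [show P ++ .inl true :: .inr h :: .inl false :: Q =
      (P ++ [.inl true]) ++ .inr h :: .inl false :: Q by simp] at ht
    rcases List.eq_or_exists_of_append_cons_eq ht with
      ⟨h1, h2, h3⟩ | ⟨M, h1, h2⟩ | ⟨M, h1, h2⟩
    · obtain rfl : b = h := by simpa using h2
      have hl : l = leaf := by
        cases l with
        | leaf => rfl
        | node l c l' =>
          obtain ⟨C, hC⟩ := exists_inorder_node l c l'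
          rw [hC] at h1
          simpa using (List.append_inj' h1 rfl).2
      have hr : r = leaf := by
        cases r with
        | leaf => rfl
        | node r c r' =>
          obtain ⟨C, hC⟩ := exists_inorder_node r c r'
          rw [hC] at h3
          simp at h3
      subst hl hr
      obtain rfl : P = [] := by cases P <;> simp_all [inorder]
      obtain rfl : Q = [] := by simpa [inorder] using h3.symm
      exact ⟨leaf, o, rfl, rfl⟩
    · obtain ⟨N, rfl, rfl⟩ : ∃ N, M = N ++ [.inl true] ∧ P = l.inorder true ++ .inr b :: N := by
        rcases List.eq_nil_or_concat' M with rfl | ⟨M, m, rfl⟩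
        · simpa using (List.append_inj' (s₁ := P) (t₁ := [.inl true]) h1 rfl).2
        · obtain ⟨e1, e2⟩ := List.append_inj' (s₁ := P) (t₁ := [.inl true])
            (s₂ := l.inorder true ++ .inr b :: M) (t₂ := [m]) (by simpa using h1) rfl
          exact ⟨M, by rw [e2], e1⟩
      obtain ⟨t', o', e1, e2⟩ := ihr (o := false) (P := N) (Q := Q) (by simpa using h2)
        (fun a ha => hP a (by simp [ha])) hQ
      refine ⟨node l b t', o', by simp [inorder, e1], ?_⟩
      have : b < h := hP b (by simp)
      simp [insL, this.not_gt, e2]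
    · cases M with
      | nil => simp at h2
      | cons m M =>
        simp only [List.cons_append, List.cons.injEq] at h2
        obtain ⟨rfl, rfl⟩ := h2
        obtain ⟨t', o', e1, e2⟩ := ihl (o := true) (P := P) (Q := M) (by simpa using h1)
          hP (fun a ha => hQ a (by simp [ha]))
        refine ⟨node t' b r, o', by simp [inorder, e1], ?_⟩
        have : h < b := hQ b (by simp)
        simp [insL, this, e2]

theorem exists_ofList_eq {C : List (Bool ⊕ A)} {L R : LTree A}
    (hL : L.inorder true = .inl true :: C ++ [.inl false])
    (hR : R.inorder true = .inl true :: C.map (Sum.map (!·) id) ++ [.inl false])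
    (hC : (C.filterMap Sum.getRight?).Pairwise (· < ·)) :
    ∃ w, ofList w = L ∧ ofList w.reverse = R := by
  induction hn : C.length using Nat.strong_induction_on generalizing C L R with
  | _ n ih =>
    cases L with
    | leaf => simp [inorder] at hL
    | node l h r =>
      have hlab : (l.toList ++ h :: r.toList).Pairwise (· < ·) := by
        have := filterMap_inorder (node l h r) true
        rw [hL] at this
        simp only [toList] at this
        rw [← this]
        simpa [List.filterMap_append, List.filterMap_cons] using hC
      have hl : ∀ a ∈ l.toList, a < h := fun a ha =>
        (List.pairwise_append.1 hlab).2.2 a ha h (by simp)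
      have hr : ∀ a ∈ r.toList, h < a :=
        (List.pairwise_cons.1 (List.pairwise_append.1 hlab).2.1).1
      have hr' : ∀ a ∈ r.toList, h ≤ a := fun a ha => (hr a ha).le
      simp only [inorder] at hL
      have key : ∀ {w : List A} {L' R' : LTree A}, ofList w = L' → ofList w.reverse = R' →
          cutLt h L' = l → cutGe h L' = r → insL R' h = R →
          ∃ w, ofList w = node l h r ∧ ofList w.reverse = R := by
        rintro w _ _ rfl rfl h1 h2 h3
        exact ⟨h :: w, by rw [ofList_cons, ofList_filter_lt, ofList_filter_ge, h1, h2],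
          by rw [List.reverse_cons, ofList_concat, h3]⟩
      cases hlc : l with
      | leaf =>
        subst hlc
        cases hrc : r with
        | leaf =>
          subst hrc
          obtain rfl : C = [.inr h] := by
            refine (List.append_cancel_right (List.cons_injective (hL.symm.trans ?_)))
            simp [inorder]
          obtain ⟨R', o', e1, e2⟩ := exists_insL_eq (t := R) (h := h) (o := true)
            (P := []) (Q := []) (by simp [hR]) (by simp) (by simp)
          refine key (w := []) rfl (L' := leaf) (R' := R') ?_ rfl rfl e2
          cases R' with
          | leaf => rfl
          | node r₁ c r₂ =>
            obtain ⟨D, hD⟩ := exists_inorder_node r₁ c r₂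
            simp [hD] at e1
        | node r₁ c r₂ =>
          rw [← hrc]
          obtain ⟨C₂, hC₂⟩ := exists_inorder_node r₁ c r₂
          rw [← hrc] at hC₂
          obtain rfl : C = .inr h :: .inl true :: C₂ := by
            rw [hC₂] at hL
            refine List.append_cancel_right (List.cons_injective (hL.symm.trans ?_))
            simp [inorder]
          obtain ⟨R', o', e1, e2⟩ := exists_insL_eq (t := R) (h := h) (o := true)
            (P := []) (Q := C₂.map (Sum.map (!·) id) ++ [.inl false]) (by simp [hR]) (by simp)
            (fun a ha => hr a (by
              rw [← inr_mem_inorder (o := false), hC₂]; simpa using ha))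
          obtain rfl : o' = true := by
            obtain ⟨D, hD⟩ := exists_inorder_left R'
            rw [hD] at e1
            simpa using (List.cons.inj e1).1.symm
          obtain ⟨w, hw1, hw2⟩ := ih _ (by simp at hn ⊢; omega) (hC₂ true) (R := R')
            (by simp [e1]) (by simpa [List.filterMap_cons] using (List.pairwise_cons.1 hC).2) rfl
          exact key hw1 hw2 (cutLt_eq_leaf hr') (cutGe_eq_self hr') e2
      | node l₁ b l₂ =>
        rw [← hlc]
        obtain ⟨C₁, hC₁⟩ := exists_inorder_node l₁ b l₂
        rw [← hlc] at hC₁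
        cases hrc : r with
        | leaf =>
          subst hrc
          obtain rfl : C = C₁ ++ [.inl false, .inr h] := by
            rw [hC₁] at hL
            refine List.append_cancel_right (List.cons_injective (hL.symm.trans ?_))
            simp [inorder]
          obtain ⟨R', o', e1, e2⟩ := exists_insL_eq (t := R) (h := h) (o := true)
            (P := .inl true :: C₁.map (Sum.map (!·) id)) (Q := []) (by simp [hR])
            (fun a ha => hl a (by
              rw [← inr_mem_inorder (o := true), hC₁]; simpa using ha)) (by simp)
          obtain rfl : o' = false := by
            cases R' with
            | leaf => simp [inorder] at e1
            | node r₁ c r₂ =>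
              obtain ⟨D, hD⟩ := exists_inorder_node r₁ c r₂
              rw [hD] at e1
              simpa using (List.append_inj' e1 rfl).2.symm
          obtain ⟨w, hw1, hw2⟩ := ih _ (by simp at hn ⊢; omega) (hC₁ true) (R := R')
            (by simp [e1]) (hC.sublist (by simp)) rfl
          exact key hw1 hw2 (cutLt_eq_self hl) (cutGe_eq_leaf hl) e2
        | node r₁ c r₂ =>
          rw [← hrc]
          obtain ⟨C₂, hC₂⟩ := exists_inorder_node r₁ c r₂
          rw [← hrc] at hC₂
          obtain rfl : C = C₁ ++ [.inl false, .inr h, .inl true] ++ C₂ := by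
            rw [hC₁, hC₂] at hL
            refine List.append_cancel_right (List.cons_injective (hL.symm.trans ?_))
            simp
          obtain ⟨R', o', e1, e2⟩ := exists_insL_eq (t := R) (h := h) (o := true)
            (P := .inl true :: C₁.map (Sum.map (!·) id))
            (Q := C₂.map (Sum.map (!·) id) ++ [.inl false]) (by simp [hR])
            (fun a ha => hl a (by
              rw [← inr_mem_inorder (o := true), hC₁]; simpa using ha))
            (fun a ha => hr a (by
              rw [← inr_mem_inorder (o := false), hC₂]; simpa using ha))
          obtain ⟨L', h1, h2, h3⟩ : ∃ L' : LTree A,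
              L'.inorder true = .inl true :: (C₁ ++ .inl (!o') :: C₂) ++ [.inl false] ∧
              cutLt h L' = l ∧ cutGe h L' = r := by
            cases o' with
            | true =>
              exact ⟨graftFirst l r, by rw [inorder_graftFirst (hC₂ true), hC₁]; simp,
                cutLt_graftFirst hl hr', cutGe_graftFirst hl hr'⟩
            | false =>
              exact ⟨graftLast l r, by rw [inorder_graftLast (hC₁ true), hC₂]; simp,
                cutLt_graftLast hl hr', cutGe_graftLast hl hr'⟩
          obtain ⟨w, hw1, hw2⟩ := ih _ (by simp at hn ⊢; omega) h1 (R := R')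
            (by simp [e1])
            (hC.sublist (by
              simp only [List.filterMap_append, List.filterMap_cons, Sum.getRight?_inl]
              simp)) rfl
          exact key hw1 hw2 h2 h3 e2

end LTree

namespace BTree

/-- The labeling of the nodes of a tree by consecutive integers in inorder, starting at `s`. -/
def label : BTree → ℕ → LTree ℕ
  | leaf, _ => .leaf
  | node l r, s => .node (label l s) (s + l.size) (label r (s + l.size + 1))

theorem shape_label (t : BTree) (s : ℕ) : (t.label s).shape = t := by
  induction t generalizing s with
  | leaf => rfl
  | node l r ihl ihr => simp [label, shape, ihl, ihr]

theorem toList_label (t : BTree) (s : ℕ) : (t.label s).toList = List.range' s t.size := by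
  induction t generalizing s with
  | leaf => rfl
  | node l r ihl ihr =>
    rw [label, toList, ihl, ihr, size, add_assoc l.size, ← List.range'_append_1, List.range'_succ]

end BTree

/-- The alternating list with left entries `K` and right entries `M`, starting on the right. -/
def List.interleaveSum {A : Type*} (K : List Bool) (M : List A) : List (Bool ⊕ A) :=
  (M.zip K).flatMap fun p => [.inr p.1, .inl p.2]

theorem LTree.inorder_eq_interleaveSum {A : Type*} (t : LTree A) (o : Bool) :
    ∃ a K, t.inorder o = .inl a :: List.interleaveSum K t.toList ∧ K.length = t.toList.length ∧
      t.shape.leafOrients o = a :: K := by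
  induction t generalizing o with
  | leaf => exact ⟨o, [], rfl, rfl, rfl⟩
  | node l b r ihl ihr =>
    obtain ⟨a, K, h1, h2, h3⟩ := ihl true
    obtain ⟨a', K', h1', h2', h3'⟩ := ihr false
    refine ⟨a, K ++ a' :: K', ?_, by simp [toList, h2, h2'], by
      simp [shape, BTree.leafOrients, h3, h3']⟩
    simp [inorder, h1, h1', toList, List.interleaveSum, List.zip_append h2.symm]

theorem LTree.inorder_node_eq {A : Type*} {l r : LTree A} {b a : A} {M : List A}
    (h : (node l b r).toList = M ++ [a]) :
    (node l b r).inorder true = .inl true ::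
      (List.interleaveSum (node l b r).shape.canopy M ++ [.inr a]) ++ [.inl false] := by
  obtain ⟨c, K, h1, h2, h3⟩ := inorder_eq_interleaveSum (node l b r) true
  rw [shape, BTree.leafOrients_node_eq_canopy, List.cons_append, List.cons.injEq] at h3
  obtain ⟨rfl, rfl⟩ := h3
  rw [h] at h1 h2
  have hlen : M.length = (node l b r).shape.canopy.length := by simpa [shape] using h2.symm
  rw [h1, List.interleaveSum, ← shape, List.zip_append hlen]
  simp [List.interleaveSum]

theorem List.map_interleaveSum {A : Type*} (K : List Bool) (M : List A) :
    (interleaveSum K M).map (Sum.map (!·) id) = interleaveSum (K.map (!·)) M := by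
  simp [interleaveSum, List.zip_map_right, List.map_flatMap, List.flatMap_map]

theorem TwinPair.exists_ofList_eq {L R : BTree} (h : TwinPair L R) (s : ℕ) :
    ∃ w : List ℕ, w.Perm (List.range' s L.size) ∧ (ofList w).shape = L ∧
      (ofList w.reverse).shape = R := by
  cases L with
  | leaf =>
    cases R with
    | leaf => exact ⟨[], .refl _, rfl, rfl⟩
    | node => simp [TwinPair, BTree.size] at h
  | node l r =>
    cases R with
    | leaf => simp [TwinPair, BTree.size] at h
    | node l' r' =>
      have hM : List.range' s (BTree.node l r).size =
          List.range' s (l.size + r.size) ++ [s + (l.size + r.size)] := by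
        rw [BTree.size, List.range'_1_concat]
      have eL := LTree.inorder_node_eq ((BTree.toList_label (.node l r) s).trans hM)
      have eR := LTree.inorder_node_eq ((BTree.toList_label (.node l' r') s).trans (h.1 ▸ hM))
      have sL : (LTree.node (l.label s) (s + l.size) (r.label (s + l.size + 1))).shape =
        .node l r := BTree.shape_label (.node l r) s
      have sR : (LTree.node (l'.label s) (s + l'.size) (r'.label (s + l'.size + 1))).shape =
        .node l' r' := BTree.shape_label (.node l' r') s
      rw [sL] at eL
      rw [sR, h.canopy_eq, ← List.map_interleaveSum] at eR
      obtain ⟨w, h1, h2⟩ := LTree.exists_ofList_eq eL (by simpa using eR) (by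
        have := filterMap_inorder (BTree.label (.node l r) s) true
        rw [BTree.label, eL] at this
        have e : _ = List.range' s (BTree.node l r).size :=
          this.trans (BTree.toList_label (.node l r) s)
        simp only [List.filterMap_append, List.filterMap_cons, Sum.getRight?_inl,
          List.filterMap_nil, List.append_nil, List.cons_append] at e ⊢
        rw [e]
        exact List.pairwise_lt_range')
      refine ⟨w, ?_, by rw [h1, sL], by rw [h2, sR]⟩
      have := toList_ofList_perm w
      rw [h1] at this
      exact this.symm.trans (.of_eq (BTree.toList_label (.node l r) s))

theorem shP_eq {σ : List ℕ} (h : σ.Nodup) :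
    shP σ = ((ofList σ).shape, (ofList σ.reverse).shape) := by
  rw [shP, foldl_insR_eq_ofList (List.nodup_reverse.2 h)]
  rfl

theorem isPermWord_iff {n : ℕ} {σ : List ℕ} : IsPermWord n σ ↔ σ.Perm (List.range' 1 n) := by
  simp [IsPermWord, List.map_add_range', List.range_eq_range', add_comm _ 1]

/-- For any `n ≥ 0`, the map `σ ↦ sh(P(σ))` induces a bijection
between the `≡_B`-equivalence classes of permutations of size `n` and the pairs
of twin binary trees with `n` nodes: it is constant exactly on classes, lands in
the set of twin pairs with `n` nodes, and attains each of them. -/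
theorem baxterClasses_biject_twinPairs (n : ℕ) :
    (∀ σ ν : List ℕ, IsPermWord n σ → IsPermWord n ν →
        (BaxterEquiv σ ν ↔ shP σ = shP ν)) ∧
    (∀ σ : List ℕ, IsPermWord n σ →
        TwinPair (shP σ).1 (shP σ).2 ∧ (shP σ).1.size = n) ∧
    (∀ L R : BTree, TwinPair L R → L.size = n →
        ∃ σ : List ℕ, IsPermWord n σ ∧ shP σ = (L, R)) := by
  have hnd : ∀ {σ}, IsPermWord n σ → σ.Nodup := fun h =>
    (isPermWord_iff.1 h).nodup_iff.2 List.nodup_range'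
  refine ⟨fun σ ν hσ hν => ?_, fun σ hσ => ?_, fun L R h hn => ?_⟩
  · rw [shP_eq (hnd hσ), shP_eq (hnd hν), Prod.mk.injEq]
    refine ⟨fun h => ⟨by rw [h.ofList_eq], by rw [h.ofList_reverse_eq (hnd hσ)]⟩, fun h => ?_⟩
    have hp : σ.Perm ν := hσ.trans hν.symm
    exact BaxterEquiv.of_ofList_eq (p := []) (hnd hσ) hp (ofList_eq_of_shape_eq hp h.1)
      (ofList_eq_of_shape_eq
        ((List.reverse_perm σ).trans (hp.trans (List.reverse_perm ν).symm)) h.2)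
  · rw [shP_eq (hnd hσ)]
    refine ⟨twinPair_ofList (isPermWord_iff.1 hσ), ?_⟩
    simp [size_shape, (toList_ofList_perm σ).length_eq, (isPermWord_iff.1 hσ).length_eq]
  · obtain ⟨w, hw, h1, h2⟩ := h.exists_ofList_eq 1
    have hw' := isPermWord_iff.2 (hn ▸ hw)
    exact ⟨w, hw', by rw [shP_eq (hnd hw'), h1, h2]⟩
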